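/- In (End ℂⁿ)^{⊗m} ⊗ W_n, set L = M𝒟 − (q − q⁻¹)⁻¹·1 (an n×n matrix over the braided Weyl algebra W_n). For every partition μ of m with at most n rows and every standard μ-tableau U, one has (L_{1̄} + q^{−2c_1(U)}/(q − q⁻¹)) ⋯ (L_{m̄} + q^{−2c_m(U)}/(q − q⁻¹)) E_U = a_μ M_{1̄} ⋯ M_{m̄} 𝒟_{m̄} ⋯ 𝒟_{1̄} E_U, where a_μ = ∏_{α∈μ} q^{−2c(α)}. -/

import Mathlib

open scoped Classical

noncomputable section

namespace QImm

/-- `q` is not a root of unity. -/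
def NotRootOfUnity (q : ℂ) : Prop := ∀ k : ℕ, 0 < k → q ^ k ≠ 1

/-! ### The R-matrices -/

/-- The R-matrix `R = q ∑ eᵢᵢ⊗eᵢᵢ + ∑_{i≠j} eᵢᵢ⊗eⱼⱼ + (q-q⁻¹) ∑_{i<j} eᵢⱼ⊗eⱼᵢ`. -/
def Rmat (q : ℂ) (n : ℕ) : Matrix (Fin n × Fin n) (Fin n × Fin n) ℂ := fun p r =>
  if p.1 = r.1 ∧ p.2 = r.2 then (if p.1 = p.2 then q else 1)
  else if p.2 = r.1 ∧ p.1 = r.2 ∧ p.1 < r.1 then q - q⁻¹ else 0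

/-- The permutation operator `P = ∑ eᵢⱼ⊗eⱼᵢ`. -/
def Pmat (n : ℕ) : Matrix (Fin n × Fin n) (Fin n × Fin n) ℂ := fun p r =>
  if p.1 = r.2 ∧ p.2 = r.1 then 1 else 0

/-- `Ř = P R`. -/
def Rcheck (q : ℂ) (n : ℕ) : Matrix (Fin n × Fin n) (Fin n × Fin n) ℂ :=
  Pmat n * Rmat q n

/-! ### Embeddings into tensor legs: `(End ℂⁿ)^{⊗m} ⊗ A ≅ Matrix (Fin m → Fin n) (Fin m → Fin n) A` -/

/-- An `n×n` matrix over `A` placed in the `a`-th tensor leg (0-indexed) of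
`(End ℂⁿ)^{⊗m} ⊗ A`. -/
def leg1 {A : Type} [Ring A] (n m : ℕ) (X : Matrix (Fin n) (Fin n) A) (a : ℕ) :
    Matrix (Fin m → Fin n) (Fin m → Fin n) A := fun i j =>
  if h : a < m then
    if ∀ c : Fin m, (c : ℕ) ≠ a → i c = j c then X (i ⟨a, h⟩) (j ⟨a, h⟩) else 0
  else 0

/-- A scalar element of `End ℂⁿ ⊗ End ℂⁿ` placed in the `a`-th and `b`-th tensor legs
(0-indexed) of `(End ℂⁿ)^{⊗m} ⊗ A`. -/
def leg2 (A : Type) [Ring A] [Algebra ℂ A] (n m : ℕ)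
    (C : Matrix (Fin n × Fin n) (Fin n × Fin n) ℂ) (a b : ℕ) :
    Matrix (Fin m → Fin n) (Fin m → Fin n) A := fun i j =>
  if h : a < m ∧ b < m then
    if ∀ c : Fin m, (c : ℕ) ≠ a → (c : ℕ) ≠ b → i c = j c then
      algebraMap ℂ A (C (i ⟨a, h.1⟩, i ⟨b, h.2⟩) (j ⟨a, h.1⟩, j ⟨b, h.2⟩))
    else 0
  else 0

/-- `Ř_{k+1}` (paper numbering), acting in the tensor legs `k`, `k+1` (0-indexed). -/
def RcLeg (A : Type) [Ring A] [Algebra ℂ A] (q : ℂ) (n m : ℕ) (k : ℕ) :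
    Matrix (Fin m → Fin n) (Fin m → Fin n) A :=
  leg2 A n m (Rcheck q n) k (k + 1)

/-- `Ř⁻¹_{k+1}` (paper numbering), acting in the tensor legs `k`, `k+1` (0-indexed). -/
def RcLegInv (A : Type) [Ring A] [Algebra ℂ A] (q : ℂ) (n m : ℕ) (k : ℕ) :
    Matrix (Fin m → Fin n) (Fin m → Fin n) A :=
  leg2 A n m (Rcheck q n)⁻¹ k (k + 1)

/-- `legBar q n m X k` is `X_{\overline{k+1}}` (paper numbering), so `legBar q n m X 0 = X₁`
and `X_{\overline{k+1}} = Ř_k X_{\overline{k}} Ř_k⁻¹`. -/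
def legBar {A : Type} [Ring A] [Algebra ℂ A] (q : ℂ) (n m : ℕ)
    (X : Matrix (Fin n) (Fin n) A) : ℕ → Matrix (Fin m → Fin n) (Fin m → Fin n) A
  | 0 => leg1 n m X 0
  | k + 1 => RcLeg A q n m k * legBar q n m X k * RcLegInv A q n m k

/-! ### q-traces -/

/-- The q-trace over all `m` tensor legs: `tr_{q(1,…,m)} Y = tr D₁⋯D_m Y` with
`D = diag(1, q⁻², …, q^{-2n+2})`. -/
def qTr {A : Type} [Ring A] [Algebra ℂ A] (q : ℂ) (n m : ℕ)
    (Y : Matrix (Fin m → Fin n) (Fin m → Fin n) A) : A :=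
  ∑ i : Fin m → Fin n,
    algebraMap ℂ A (∏ a : Fin m, q ^ (-2 * ((i a : ℕ) : ℤ))) * Y i i

/-- The q-trace of a single `n×n` matrix: `tr_q X = tr D X`. -/
def qTr1 {A : Type} [Ring A] [Algebra ℂ A] (q : ℂ) (n : ℕ)
    (X : Matrix (Fin n) (Fin n) A) : A :=
  ∑ j : Fin n, algebraMap ℂ A (q ^ (-2 * ((j : ℕ) : ℤ))) * X j j

/-! ### The Hecke algebra -/

/-- The defining relations of the Hecke algebra `H_m` on generators `T_1, …, T_{m-1}`
(the generator `i : Fin (m-1)` is `T_{i+1}` in 1-indexed paper notation). -/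
inductive HeckeRel (q : ℂ) (m : ℕ) :
    FreeAlgebra ℂ (Fin (m - 1)) → FreeAlgebra ℂ (Fin (m - 1)) → Prop
  | quad (i : Fin (m - 1)) :
      HeckeRel q m
        ((FreeAlgebra.ι ℂ i - algebraMap ℂ (FreeAlgebra ℂ (Fin (m - 1))) q) *
          (FreeAlgebra.ι ℂ i + algebraMap ℂ (FreeAlgebra ℂ (Fin (m - 1))) q⁻¹)) 0
  | braid (i j : Fin (m - 1)) (h : (j : ℕ) = (i : ℕ) + 1) :
      HeckeRel q m (FreeAlgebra.ι ℂ i * FreeAlgebra.ι ℂ j * FreeAlgebra.ι ℂ i)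
        (FreeAlgebra.ι ℂ j * FreeAlgebra.ι ℂ i * FreeAlgebra.ι ℂ j)
  | commute (i j : Fin (m - 1)) (h : (i : ℕ) + 1 < (j : ℕ)) :
      HeckeRel q m (FreeAlgebra.ι ℂ i * FreeAlgebra.ι ℂ j)
        (FreeAlgebra.ι ℂ j * FreeAlgebra.ι ℂ i)

/-- The Hecke algebra `H_m`. -/
abbrev Hecke (q : ℂ) (m : ℕ) := RingQuot (HeckeRel q m)

/-- The generator `T_{i+1}` (paper 1-indexed) of `H_m`. -/
def Tgen (q : ℂ) (m : ℕ) (i : Fin (m - 1)) : Hecke q m :=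
  RingQuot.mkAlgHom ℂ (HeckeRel q m) (FreeAlgebra.ι ℂ i)

/-- `T_{k+1}` (paper 1-indexed), i.e. the 0-indexed `k`-th generator; junk value `1`
out of range. -/
def Tn (q : ℂ) (m : ℕ) (k : ℕ) : Hecke q m :=
  if h : k < m - 1 then Tgen q m ⟨k, h⟩ else 1

/-- The paper's 1-indexed generator `T_a`, `a = 1, …, m-1`. -/
def Tp (q : ℂ) (m : ℕ) (a : ℕ) : Hecke q m := Tn q m (a - 1)

/-- The Jucys–Murphy elements, 1-indexed: `y_1 = 1`, `y_{k+1} = T_k ⋯ T_2 T_1² T_2 ⋯ T_k`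
(the value at `0` is a junk value `1`). -/
def yJM (q : ℂ) (m : ℕ) : ℕ → Hecke q m
  | 0 => 1
  | 1 => 1
  | k + 2 => Tp q m (k + 1) * yJM q m (k + 1) * Tp q m (k + 1)

/-- The element `T_{(i,j)} = T_i T_{i+1} ⋯ T_{j-2} T_{j-1} T_{j-2} ⋯ T_{i+1} T_i` of `H_m`
associated with the transposition `(i,j)`, `1 ≤ i < j` (paper 1-indexed). -/
def Ttrans (q : ℂ) (m : ℕ) (i j : ℕ) : Hecke q m :=
  ((List.range' i (j - i)).map (Tp q m)).prod *
    (((List.range' i (j - 1 - i)).map (Tp q m)).reverse).prod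

/-- The condition that `φ : H_m → End((ℂⁿ)^{⊗m})` is the algebra homomorphism sending
`T_k ↦ Ř_k`. -/
def IsHeckeRep (q : ℂ) (n m : ℕ)
    (φ : Hecke q m →ₐ[ℂ] Matrix (Fin m → Fin n) (Fin m → Fin n) ℂ) : Prop :=
  ∀ k : ℕ, k < m - 1 → φ (Tn q m k) = RcLeg ℂ q n m k

/-! ### Young diagrams and standard tableaux -/

/-- The content `c(α) = j - i` of a box `α = (i, j)` (row `i`, column `j`, 0-indexed). -/
def ctn (α : ℕ × ℕ) : ℤ := (α.2 : ℤ) - (α.1 : ℤ)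

/-- A standard tableau of shape `μ` with `m` boxes, recorded via the position `pos k` of
each entry `k ∈ {1, …, m}`; entries strictly increase along rows and down columns. -/
structure StdTab (μ : YoungDiagram) (m : ℕ) where
  pos : ℕ → ℕ × ℕ
  bij : Set.BijOn pos (Set.Icc 1 m) (μ.cells : Set (ℕ × ℕ))
  row_lt : ∀ k ∈ Set.Icc 1 m, ∀ l ∈ Set.Icc 1 m,
    (pos k).1 = (pos l).1 → (pos k).2 < (pos l).2 → k < l
  col_lt : ∀ k ∈ Set.Icc 1 m, ∀ l ∈ Set.Icc 1 m,
    (pos k).2 = (pos l).2 → (pos k).1 < (pos l).1 → k < l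

/-- `c_k(U)`, the content of the box of `U` occupied by `k`. -/
def ctnAt {μ : YoungDiagram} {m : ℕ} (U : StdTab μ m) (k : ℕ) : ℤ := ctn (U.pos k)

/-- The condition singling out the primitive idempotent `e_U` of `H_m` associated with a
standard tableau `U`: a nonzero idempotent with `y_k e_U = e_U y_k = q^{2c_k(U)} e_U`. -/
def IsJMIdem (q : ℂ) (m : ℕ) {μ : YoungDiagram} (U : StdTab μ m) (e : Hecke q m) : Prop :=
  e ≠ 0 ∧ e * e = e ∧ ∀ k : ℕ, 1 ≤ k → k ≤ m →
    yJM q m k * e = (q ^ (2 * ctnAt U k) : ℂ) • e ∧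
    e * yJM q m k = (q ^ (2 * ctnAt U k) : ℂ) • e

/-! ### The quantized enveloping algebra `U_q(gl_n)` -/

/-- Generators: `inl (i,j) ↦ l⁺_{ij}`, `inr (i,j) ↦ l⁻_{ij}`. -/
abbrev UqGen (n : ℕ) := (Fin n × Fin n) ⊕ (Fin n × Fin n)

def lpF (n : ℕ) (i j : Fin n) : FreeAlgebra ℂ (UqGen n) := FreeAlgebra.ι ℂ (Sum.inl (i, j))
def lmF (n : ℕ) (i j : Fin n) : FreeAlgebra ℂ (UqGen n) := FreeAlgebra.ι ℂ (Sum.inr (i, j))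

/-- A matrix `X` over `F` placed in the first of two matrix legs of
`End ℂⁿ ⊗ End ℂⁿ ⊗ F`. -/
def M1 {F : Type} [Ring F] {n : ℕ} (X : Fin n → Fin n → F) :
    Matrix (Fin n × Fin n) (Fin n × Fin n) F := fun p r => if p.2 = r.2 then X p.1 r.1 else 0

/-- A matrix `X` over `F` placed in the second of two matrix legs of
`End ℂⁿ ⊗ End ℂⁿ ⊗ F`. -/
def M2 {F : Type} [Ring F] {n : ℕ} (X : Fin n → Fin n → F) :
    Matrix (Fin n × Fin n) (Fin n × Fin n) F := fun p r => if p.1 = r.1 then X p.2 r.2 else 0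

/-- The R-matrix, viewed over the free algebra on the generators of `U_q(gl_n)`. -/
def RmatU (q : ℂ) (n : ℕ) : Matrix (Fin n × Fin n) (Fin n × Fin n) (FreeAlgebra ℂ (UqGen n)) :=
  (Rmat q n).map (algebraMap ℂ (FreeAlgebra ℂ (UqGen n)))

/-- The defining relations of `U_q(gl_n)`. -/
inductive UqRel (q : ℂ) (n : ℕ) :
    FreeAlgebra ℂ (UqGen n) → FreeAlgebra ℂ (UqGen n) → Prop
  | upperZero (i j : Fin n) (h : j < i) : UqRel q n (lpF n i j) 0
  | lowerZero (i j : Fin n) (h : i < j) : UqRel q n (lmF n i j) 0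
  | diagPM (i : Fin n) : UqRel q n (lpF n i i * lmF n i i) 1
  | diagMP (i : Fin n) : UqRel q n (lmF n i i * lpF n i i) 1
  | rllPP (x y : Fin n × Fin n) :
      UqRel q n ((RmatU q n * M1 (lpF n) * M2 (lpF n)) x y)
        ((M2 (lpF n) * M1 (lpF n) * RmatU q n) x y)
  | rllMM (x y : Fin n × Fin n) :
      UqRel q n ((RmatU q n * M1 (lmF n) * M2 (lmF n)) x y)
        ((M2 (lmF n) * M1 (lmF n) * RmatU q n) x y)
  | rllPM (x y : Fin n × Fin n) :
      UqRel q n ((RmatU q n * M1 (lpF n) * M2 (lmF n)) x y)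
        ((M2 (lmF n) * M1 (lpF n) * RmatU q n) x y)

/-- The quantized enveloping algebra `U_q(gl_n)`. -/
abbrev Uq (q : ℂ) (n : ℕ) := RingQuot (UqRel q n)

def lp (q : ℂ) (n : ℕ) (i j : Fin n) : Uq q n := RingQuot.mkAlgHom ℂ (UqRel q n) (lpF n i j)
def lm (q : ℂ) (n : ℕ) (i j : Fin n) : Uq q n := RingQuot.mkAlgHom ℂ (UqRel q n) (lmF n i j)

/-- The matrix `L⁺`. -/
def Lp (q : ℂ) (n : ℕ) : Matrix (Fin n) (Fin n) (Uq q n) := Matrix.of fun i j => lp q n i j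
/-- The matrix `L⁻`. -/
def Lm (q : ℂ) (n : ℕ) : Matrix (Fin n) (Fin n) (Uq q n) := Matrix.of fun i j => lm q n i j

/-- `L = L⁺ (L⁻)⁻¹`, where `K` is the (two-sided) inverse of `L⁻`. -/
def Lmat (q : ℂ) (n : ℕ) (K : Matrix (Fin n) (Fin n) (Uq q n)) :
    Matrix (Fin n) (Fin n) (Uq q n) := Lp q n * K

/-! ### The braided Weyl algebra -/

/-- Generators: `inl (i,j) ↦ m_{ij}`, `inr (i,j) ↦ ∂_{ij}`. -/
abbrev WGen (n : ℕ) := (Fin n × Fin n) ⊕ (Fin n × Fin n)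

def mgF (n : ℕ) (i j : Fin n) : FreeAlgebra ℂ (WGen n) := FreeAlgebra.ι ℂ (Sum.inl (i, j))
def dgF (n : ℕ) (i j : Fin n) : FreeAlgebra ℂ (WGen n) := FreeAlgebra.ι ℂ (Sum.inr (i, j))

def RcW (q : ℂ) (n : ℕ) : Matrix (Fin n × Fin n) (Fin n × Fin n) (FreeAlgebra ℂ (WGen n)) :=
  (Rcheck q n).map (algebraMap ℂ (FreeAlgebra ℂ (WGen n)))

def RcWInv (q : ℂ) (n : ℕ) : Matrix (Fin n × Fin n) (Fin n × Fin n) (FreeAlgebra ℂ (WGen n)) :=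
  ((Rcheck q n)⁻¹).map (algebraMap ℂ (FreeAlgebra ℂ (WGen n)))

/-- The defining relations of the braided Weyl algebra `W_n`. -/
inductive WRel (q : ℂ) (n : ℕ) :
    FreeAlgebra ℂ (WGen n) → FreeAlgebra ℂ (WGen n) → Prop
  | mm (x y : Fin n × Fin n) :
      WRel q n ((RcW q n * M1 (mgF n) * RcW q n * M1 (mgF n)) x y)
        ((M1 (mgF n) * RcW q n * M1 (mgF n) * RcW q n) x y)
  | dd (x y : Fin n × Fin n) :
      WRel q n ((RcWInv q n * M1 (dgF n) * RcWInv q n * M1 (dgF n)) x y)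
        ((M1 (dgF n) * RcWInv q n * M1 (dgF n) * RcWInv q n) x y)
  | dm (x y : Fin n × Fin n) :
      WRel q n ((M1 (dgF n) * RcW q n * M1 (mgF n)) x y)
        ((RcW q n * M1 (mgF n) * RcWInv q n * M1 (dgF n) * RcWInv q n + 1) x y)

/-- The braided Weyl algebra `W_n`. -/
abbrev Weyl (q : ℂ) (n : ℕ) := RingQuot (WRel q n)

def mW (q : ℂ) (n : ℕ) (i j : Fin n) : Weyl q n := RingQuot.mkAlgHom ℂ (WRel q n) (mgF n i j)
def dW (q : ℂ) (n : ℕ) (i j : Fin n) : Weyl q n := RingQuot.mkAlgHom ℂ (WRel q n) (dgF n i j)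

/-- The matrix `M = [m_{ij}]` over `W_n`. -/
def Mmat (q : ℂ) (n : ℕ) : Matrix (Fin n) (Fin n) (Weyl q n) := Matrix.of fun i j => mW q n i j
/-- The matrix `𝒟 = [∂_{ij}]` over `W_n`. -/
def Dmat (q : ℂ) (n : ℕ) : Matrix (Fin n) (Fin n) (Weyl q n) := Matrix.of fun i j => dW q n i j

/-- The image `L = M𝒟 - (q - q⁻¹)⁻¹·1` of `L` in the braided Weyl algebra. -/
def LW (q : ℂ) (n : ℕ) : Matrix (Fin n) (Fin n) (Weyl q n) :=
  Mmat q n * Dmat q n - ((q - q⁻¹)⁻¹ : ℂ) • 1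

/-! ### The q-immanant polynomials -/

/-- The matrix `(L_{1̄} + z q^{-2c₁(U)}) ⋯ (L_{m̄} + z q^{-2c_m(U)}) E_U`, where `E` is the
image `E_U` of the primitive idempotent `e_U`. -/
def prodU {A : Type} [Ring A] [Algebra ℂ A] (q : ℂ) (n m : ℕ) {μ : YoungDiagram}
    (U : StdTab μ m) (E : Matrix (Fin m → Fin n) (Fin m → Fin n) ℂ)
    (X : Matrix (Fin n) (Fin n) A) (z : ℂ) :
    Matrix (Fin m → Fin n) (Fin m → Fin n) A :=
  (((List.range m).map fun k =>
      legBar q n m X k + ((z * q ^ (-2 * ctnAt U (k + 1))) : ℂ) • 1)).prod *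
    E.map (algebraMap ℂ A)

/-- The q-immanant polynomial
`S_U(z) = tr_{q(1,…,m)} (L_{1̄} + z q^{-2c₁(U)}) ⋯ (L_{m̄} + z q^{-2c_m(U)}) E_U`. -/
def SUpoly {A : Type} [Ring A] [Algebra ℂ A] (q : ℂ) (n m : ℕ) {μ : YoungDiagram}
    (U : StdTab μ m) (E : Matrix (Fin m → Fin n) (Fin m → Fin n) ℂ)
    (X : Matrix (Fin n) (Fin n) A) (z : ℂ) : A :=
  qTr q n m (prodU q n m U E X z)

/-- The coefficient `a_μ = ∏_{α ∈ μ} q^{-2c(α)}`. -/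
def aCoeff (q : ℂ) (μ : YoungDiagram) : ℂ := ∏ α ∈ μ.cells, q ^ (-2 * ctn α)

/-- `tr_{q(1,…,m)} L_{1̄} ⋯ L_{m̄} E_{(1^m)}`, where `Em` is the image of the primitive
idempotent associated with the column diagram `(1^m)`. -/
def colElem (q : ℂ) (n k : ℕ) (K : Matrix (Fin n) (Fin n) (Uq q n))
    (φk : Hecke q k →ₐ[ℂ] Matrix (Fin k → Fin n) (Fin k → Fin n) ℂ)
    (ek : Hecke q k) : Uq q n :=
  qTr q n k (((List.range k).map fun j => legBar q n k (Lmat q n K) j).prod *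
    (φk ek).map (algebraMap ℂ (Uq q n)))

/-- The semistandardness condition on a filling of the boxes of `μ` with entries in
`{1, …, n}` (encoded as `Fin n`): weakly increasing along rows, strictly increasing
down columns. -/
def SSYTCond {n : ℕ} (μ : YoungDiagram) (f : {x // x ∈ μ.cells} → Fin n) : Prop :=
  (∀ a b : {x // x ∈ μ.cells}, (a : ℕ × ℕ).1 = (b : ℕ × ℕ).1 →
    (a : ℕ × ℕ).2 ≤ (b : ℕ × ℕ).2 → f a ≤ f b) ∧
  (∀ a b : {x // x ∈ μ.cells}, (a : ℕ × ℕ).2 = (b : ℕ × ℕ).2 →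
    (a : ℕ × ℕ).1 < (b : ℕ × ℕ).1 → f a < f b)

/-- The factorial Schur polynomial `s_μ(x₁,…,x_n | a)` evaluated at `x_i = q^{2ℓ_i}`,
`ℓ_i = λ_i - i + 1` (1-indexed), with parameter sequence `a_j = z q^{1-2j}`. -/
def factSchur {n : ℕ} (q z : ℂ) (lam : Fin n → ℤ) (μ : YoungDiagram) : ℂ :=
  ∑ f : {x // x ∈ μ.cells} → Fin n,
    if SSYTCond μ f then
      ∏ α : {x // x ∈ μ.cells},
        (q ^ (2 * (lam (f α) - ((f α : ℕ) : ℤ))) +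
          z * q ^ (1 - 2 * (((f α : ℕ) : ℤ) + 1 + ctn (α : ℕ × ℕ))))
    else 0

section BraidIdentities

variable {B : Type*} [Ring B]

theorem commute_of_two_sided_inv {x t s : B} (hts : t * s = 1) (hst : s * t = 1)
    (h : Commute x t) : Commute x s :=
  h.units_inv_right (u := ⟨t, s, hts, hst⟩)

/-- A pair of neighbouring generators satisfying the braid relation, with their inverses. -/
structure BraidPair (t s t' s' : B) : Prop where
  ts : t * s = 1
  st : s * t = 1
  ts' : t' * s' = 1
  st' : s' * t' = 1
  braid : t * t' * t = t' * t * t'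

namespace BraidPair

variable {t s t' s' : B}

theorem flip (h : BraidPair t s t' s') : BraidPair t' s' t s :=
  ⟨h.ts', h.st', h.ts, h.st, h.braid.symm⟩

theorem inv (h : BraidPair t s t' s') : BraidPair s t s' t' := by
  refine ⟨h.st, h.ts, h.st', h.ts', ?_⟩
  refine left_inv_eq_right_inv (a := t * t' * t) ?_ ?_
  · calc s * s' * s * (t * t' * t) = s * s' * (s * t) * t' * t := by noncomm_ring
      _ = s * (s' * t') * t := by rw [h.st]; noncomm_ring
      _ = 1 := by rw [h.st', mul_one, h.st]
  · calc t * t' * t * (s' * s * s') = t' * t * (t' * s') * s * s' := by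
          rw [h.braid]; noncomm_ring
      _ = t' * (t * s) * s' := by rw [h.ts']; noncomm_ring
      _ = 1 := by rw [h.ts, mul_one, h.ts']

theorem inv_mul_mul (h : BraidPair t s t' s') : s * t' * t = t' * t * s' := by
  calc s * t' * t = s * (t' * t * t') * s' := by
        simp only [mul_assoc, h.ts', mul_one]
    _ = s * t * (t' * t * s') := by rw [← h.braid]; noncomm_ring
    _ = t' * t * s' := by rw [h.st, one_mul]

/-- The cross relation `D T M = T M T⁻¹ D T⁻¹ + 1` is transported by braid conjugation. -/
theorem cross_conj (h : BraidPair t s t' s') {d x : B} (hd : Commute d t') (hx : Commute x t')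
    (hdx : d * t * x = t * x * s * d * s + 1) :
    (t * d * s) * t' * (t * x * s) =
      t' * (t * x * s) * s' * (t * d * s) * s' + 1 := by
  have hds := (commute_of_two_sided_inv h.ts' h.st' hd).eq
  have hxs := (commute_of_two_sided_inv h.ts' h.st' hx).eq
  calc (t * d * s) * t' * (t * x * s) = t * d * (s * t' * t) * x * s := by noncomm_ring
    _ = t * (d * t') * t * (s' * x) * s := by rw [h.inv_mul_mul]; noncomm_ring
    _ = t * t' * (d * t * x) * s' * s := by rw [hd.eq, ← hxs]; noncomm_ring
    _ = (t * t' * t) * x * s * (d * s * s' * s) + t * (t' * s') * s := by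
        rw [hdx]; noncomm_ring
    _ = t' * t * (t' * x) * s * (d * (s * s' * s)) + 1 := by
        rw [h.braid, h.ts', mul_one, h.ts]; noncomm_ring
    _ = t' * t * x * t' * s * (d * s') * s * s' + 1 := by
        rw [h.inv.braid, ← hx.eq]; noncomm_ring
    _ = t' * t * x * (t' * s * s') * d * s * s' + 1 := by rw [hds]; noncomm_ring
    _ = t' * (t * x * s) * s' * (t * d * s) * s' + 1 := by
        rw [h.inv.flip.inv_mul_mul]; noncomm_ring

/-- The reflection relation is transported by braid conjugation. -/
theorem reflection_conj (h : BraidPair t s t' s') {d : B} (hd : Commute d t')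
    (hdd : s * d * s * d = d * s * d * s) :
    s' * (t * d * s) * s' * (t * d * s) = (t * d * s) * s' * (t * d * s) * s' := by
  have hds := (commute_of_two_sided_inv h.ts' h.st' hd).eq
  calc s' * (t * d * s) * s' * (t * d * s) = s' * t * d * (s * s' * t) * d * s := by
        noncomm_ring
    _ = s' * t * (d * t') * s * (s' * d) * s := by
        rw [← h.inv.flip.inv_mul_mul]; noncomm_ring
    _ = (s' * t * t') * d * s * d * s' * s := by rw [hd.eq, ← hds]; noncomm_ring
    _ = t * t' * (s * d * s * d) * s' * s := by rw [h.flip.inv_mul_mul]; noncomm_ring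
    _ = t * (t' * d) * s * d * (s * s' * s) := by rw [hdd]; noncomm_ring
    _ = t * d * t' * s * (d * s') * s * s' := by rw [h.inv.braid, ← hd.eq]; noncomm_ring
    _ = t * d * (t' * s * s') * d * s * s' := by rw [hds]; noncomm_ring
    _ = (t * d * s) * s' * (t * d * s) * s' := by
        rw [h.inv.flip.inv_mul_mul]; noncomm_ring

end BraidPair

end BraidIdentities

/-- Invertible elements `T 0, …, T (m - 2)` satisfying the Hecke algebra relations,
with inverses `S k`. -/
structure HeckeChain {B : Type*} [Ring B] [Algebra ℂ B] (h : ℂ) (m : ℕ) (T S : ℕ → B) :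
    Prop where
  mul_inv : ∀ k, k + 1 < m → T k * S k = 1
  inv_mul : ∀ k, k + 1 < m → S k * T k = 1
  sub_inv : ∀ k, k + 1 < m → T k - S k = h • 1
  braid : ∀ k, k + 2 < m → T k * T (k + 1) * T k = T (k + 1) * T k * T (k + 1)
  far : ∀ i j, i + 1 < j → j + 1 < m → Commute (T i) (T j)

/-- The family `X 0, …, X (m - 1)` is obtained from `X 0` by successive conjugation. -/
structure ConjChain {B : Type*} [Ring B] (m : ℕ) (T S X : ℕ → B) : Prop where
  zero : ∀ k, 1 ≤ k → k + 1 < m → Commute (X 0) (T k)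
  succ : ∀ k, k + 1 < m → X (k + 1) = T k * X k * S k

/-- The inverses of the Jucys–Murphy elements. -/
def jmInv {B : Type*} [Ring B] (S : ℕ → B) : ℕ → B
  | 0 => 1
  | k + 1 => S k * jmInv S k * S k

/-- The product `D (k - 1) ⋯ D 0`. -/
def descProd {B : Type*} [Ring B] (D : ℕ → B) : ℕ → B
  | 0 => 1
  | k + 1 => D k * descProd D k

namespace HeckeChain

variable {B : Type*} [Ring B] [Algebra ℂ B] {h : ℂ} {m : ℕ} {T S : ℕ → B}

theorem braidPair (H : HeckeChain h m T S) (k : ℕ) (hk : k + 2 < m) :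
    BraidPair (T k) (S k) (T (k + 1)) (S (k + 1)) :=
  ⟨H.mul_inv k (by omega), H.inv_mul k (by omega), H.mul_inv _ hk, H.inv_mul _ hk, H.braid k hk⟩

theorem commute_inv (H : HeckeChain h m T S) {x : B} {k : ℕ} (hk : k + 1 < m)
    (hx : Commute x (T k)) : Commute x (S k) :=
  commute_of_two_sided_inv (H.mul_inv k hk) (H.inv_mul k hk) hx

theorem commute_of_lt (H : HeckeChain h m T S) {X : ℕ → B} (hX : ConjChain m T S X)
    {j i : ℕ} (hji : j < i) (hi : i + 1 < m) : Commute (X j) (T i) := by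
  induction j with
  | zero => exact hX.zero i hji hi
  | succ j ih =>
    rw [hX.succ j (by omega)]
    have h1 : Commute (T j) (T i) := H.far j i hji hi
    have h2 : Commute (S j) (T i) := (H.commute_inv (by omega) h1.symm).symm
    exact (h1.mul_left (ih (by omega))).mul_left h2

theorem commute_of_succ_lt (H : HeckeChain h m T S) {X : ℕ → B} (hX : ConjChain m T S X)
    {i j : ℕ} (hij : i + 1 < j) (hj : j < m) : Commute (X j) (T i) := by
  induction j with
  | zero => omega
  | succ j ih =>
    rcases Nat.lt_or_ge (i + 1) j with hlt | hge
    · rw [hX.succ j hj]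
      have h1 : Commute (T j) (T i) := (H.far i j hlt hj).symm
      have h2 : Commute (S j) (T i) := (H.commute_inv hj h1.symm).symm
      exact (h1.mul_left (ih hlt (by omega))).mul_left h2
    · obtain rfl : j = i + 1 := by omega
      have P := H.braidPair i hj
      have hc := (H.commute_of_lt hX (Nat.lt_succ_self i) hj).eq
      rw [hX.succ (i + 1) hj, hX.succ i (by omega)]
      set t := T i
      set s := S i
      set t' := T (i + 1)
      set s' := S (i + 1)
      change t' * (t * X i * s) * s' * t = t * (t' * (t * X i * s) * s')
      calc t' * (t * X i * s) * s' * t = t' * t * X i * (s * s' * t) := by noncomm_ring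
        _ = t' * t * (X i * t') * s * s' := by
            rw [← P.inv.flip.inv_mul_mul]; noncomm_ring
        _ = (t' * t * t') * X i * s * s' := by rw [hc]; noncomm_ring
        _ = t * (t' * (t * X i * s) * s') := by rw [← P.braid]; noncomm_ring

theorem commute_jmInv (H : HeckeChain h m T S) {x : B} {j : ℕ} (hj : j < m)
    (hx : ∀ i, i < j → Commute x (T i)) : Commute x (jmInv S j) := by
  induction j with
  | zero => exact Commute.one_right x
  | succ j ih =>
    have h1 := H.commute_inv hj (hx j (Nat.lt_succ_self j))
    exact (h1.mul_right (ih (by omega) fun i hi => hx i (by omega))).mul_right h1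

theorem commute_descProd (H : HeckeChain h m T S) {D : ℕ → B} (hD : ConjChain m T S D)
    {k i : ℕ} (hki : k ≤ i) (hi : i + 1 < m) : Commute (descProd D k) (T i) := by
  induction k with
  | zero => exact Commute.one_left _
  | succ k ih => exact (H.commute_of_lt hD hki hi).mul_left (ih (by omega))

theorem reflection (H : HeckeChain h m T S) {D : ℕ → B} (hD : ConjChain m T S D)
    (hdd : 1 < m → S 0 * D 0 * S 0 * D 0 = D 0 * S 0 * D 0 * S 0)
    {k : ℕ} (hk : k + 1 < m) : S k * D k * S k * D k = D k * S k * D k * S k := by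
  induction k with
  | zero => exact hdd hk
  | succ k ih =>
    rw [hD.succ k (by omega)]
    exact (H.braidPair k hk).reflection_conj (H.commute_of_lt hD (Nat.lt_succ_self k) hk)
      (ih (by omega))

theorem cross (H : HeckeChain h m T S) {X D : ℕ → B} (hX : ConjChain m T S X)
    (hD : ConjChain m T S D)
    (hdx : 1 < m → D 0 * T 0 * X 0 = T 0 * X 0 * S 0 * D 0 * S 0 + 1)
    {k : ℕ} (hk : k + 1 < m) :
    D k * T k * X k = T k * X k * S k * D k * S k + 1 := by
  induction k with
  | zero => exact hdx hk
  | succ k ih =>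
    rw [hD.succ k (by omega), hX.succ k (by omega)]
    exact (H.braidPair k hk).cross_conj (H.commute_of_lt hD (Nat.lt_succ_self k) hk)
      (H.commute_of_lt hX (Nat.lt_succ_self k) hk) (ih (by omega))

theorem commute_descProd_last (H : HeckeChain h m T S) {D : ℕ → B} (hD : ConjChain m T S D)
    (hdd : 1 < m → S 0 * D 0 * S 0 * D 0 = D 0 * S 0 * D 0 * S 0)
    {k : ℕ} (hk : k + 1 < m) : Commute (descProd D (k + 2)) (T k) := by
  have hr := H.reflection hD hdd hk
  have hts := H.mul_inv k hk
  have hst := H.inv_mul k hk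
  have hc : Commute (descProd D k) (T k) := H.commute_descProd hD le_rfl hk
  have e1 : descProd D (k + 2) = D (k + 1) * D k * descProd D k := by
    simp only [descProd, mul_assoc]
  rw [e1, hD.succ k hk]
  refine Commute.mul_left ?_ hc
  set t := T k
  set s := S k
  set d := D k
  change t * d * s * d * t = t * (t * d * s * d)
  calc t * d * s * d * t = t * (t * s) * d * s * d * t := by rw [hts, mul_one]
    _ = t * t * (s * d * s * d) * t := by noncomm_ring
    _ = t * t * d * s * d * (s * t) := by rw [hr]; noncomm_ring
    _ = t * (t * d * s * d) := by rw [hst]; noncomm_ring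

/-- Moving `X k D k` through `D (k - 1) ⋯ D 0`. -/
theorem descProd_mul (H : HeckeChain h m T S) (hh : h ≠ 0) {X D : ℕ → B}
    (hX : ConjChain m T S X) (hD : ConjChain m T S D)
    (hdd : 1 < m → S 0 * D 0 * S 0 * D 0 = D 0 * S 0 * D 0 * S 0)
    (hdx : 1 < m → D 0 * T 0 * X 0 = T 0 * X 0 * S 0 * D 0 * S 0 + 1)
    {k : ℕ} (hk : k < m) :
    descProd D k * (X k * D k - h⁻¹ • (1 - jmInv S k)) =
      X k * descProd D (k + 1) * jmInv S k := by
  induction k with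
  | zero => simp [descProd, jmInv]
  | succ k ih =>
    have ih' := ih (by omega)
    have hts := H.mul_inv k hk
    have hst := H.inv_mul k hk
    have hc := (H.commute_descProd hD le_rfl hk).eq
    have hl := (H.commute_inv hk (H.commute_descProd_last hD hdd hk)).eq
    have hcr := H.cross hX hD hdx hk
    have hsub : S k = T k - h • 1 := by rw [← H.sub_inv k hk]; abel
    have e1 : descProd D (k + 1) = D k * descProd D k := rfl
    have e2 : descProd D (k + 2) = D (k + 1) * descProd D (k + 1) := rfl
    have e3 : jmInv S (k + 1) = S k * jmInv S k * S k := rfl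
    have hDk := hD.succ k hk
    have hXk := hX.succ k hk
    have ih2 : descProd D k * X k * D k =
        X k * descProd D (k + 1) * jmInv S k + h⁻¹ • (descProd D k * (1 - jmInv S k)) := by
      rw [← ih']; rw [mul_sub, mul_smul_comm]; noncomm_ring
    rw [mul_sub, mul_smul_comm, sub_eq_iff_eq_add]
    change descProd D (k + 1) * (X (k + 1) * D (k + 1)) =
      X (k + 1) * descProd D (k + 2) * jmInv S (k + 1) + _
    set t := T k
    set s := S k
    set d := D k
    set x := X k
    set w := jmInv S k
    set p := descProd D k
    have hDs : d * s = s * D (k + 1) := by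
      rw [hDk, ← mul_assoc, ← mul_assoc, hst, one_mul]
    calc descProd D (k + 1) * (X (k + 1) * D (k + 1))
        = d * (p * t) * x * (s * t) * d * s := by rw [hXk, hDk, e1]; noncomm_ring
      _ = d * t * (p * x * d) * s := by rw [hc, hst]; noncomm_ring
      _ = (d * t * x) * descProd D (k + 1) * w * s
            + h⁻¹ • (d * (t * p) * (1 - w) * s) := by
          rw [ih2]
          simp only [mul_add, add_mul, mul_smul_comm, smul_mul_assoc, mul_assoc]
      _ = (t * x * s) * (d * s) * descProd D (k + 1) * w * s + descProd D (k + 1) * w * s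
            + h⁻¹ • (descProd D (k + 1) * (t * s - t * w * s)) := by
          rw [hcr, ← hc, e1]
          congr 1
          · noncomm_ring
          · congr 1; noncomm_ring
      _ = X (k + 1) * (s * descProd D (k + 2)) * w * s
            + h⁻¹ • (descProd D (k + 1) * (1 - (t - h • 1) * w * s)) := by
          rw [hDs, hXk, e2, hts]
          simp only [mul_sub, sub_mul, smul_sub, smul_mul_assoc, mul_smul_comm, smul_smul,
            inv_mul_cancel₀ hh, one_smul, one_mul, mul_assoc]
          abel
      _ = _ := by
          rw [← hl, ← hsub, e3]; noncomm_ring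

/-- The Capelli identity applied to a joint eigenvector of the Jucys–Murphy elements. -/
theorem capelli (H : HeckeChain h m T S) (hh : h ≠ 0) {X D : ℕ → B}
    (hX : ConjChain m T S X) (hD : ConjChain m T S D)
    (hdd : 1 < m → S 0 * D 0 * S 0 * D 0 = D 0 * S 0 * D 0 * S 0)
    (hdx : 1 < m → D 0 * T 0 * X 0 = T 0 * X 0 * S 0 * D 0 * S 0 + 1)
    (w : ℕ → ℂ) {k : ℕ} (hk : k ≤ m) (E : B)
    (hE : ∀ j, j < k → jmInv S j * E = w j • E) :
    ((List.range k).map fun j => X j * D j - (h⁻¹ : ℂ) • 1 + (h⁻¹ * w j) • 1).prod * E =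
      (∏ j ∈ Finset.range k, w j) •
        (((List.range k).map X).prod * descProd D k * E) := by
  induction k generalizing E with
  | zero => simp [descProd]
  | succ k ih =>
    have hEk := hE k (Nat.lt_succ_self k)
    have hE' : ∀ j, j < k → jmInv S j *
        ((X k * D k - (h⁻¹ : ℂ) • 1 + (h⁻¹ * w k) • 1) * E) =
          w j • ((X k * D k - (h⁻¹ : ℂ) • 1 + (h⁻¹ * w k) • 1) * E) := by
      intro j hj
      have cX : Commute (X k) (jmInv S j) := H.commute_jmInv (by omega) fun i hi =>
        H.commute_of_succ_lt hX (by omega) hk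
      have cD : Commute (D k) (jmInv S j) := H.commute_jmInv (by omega) fun i hi =>
        H.commute_of_succ_lt hD (by omega) hk
      have c : Commute (X k * D k - (h⁻¹ : ℂ) • 1 + (h⁻¹ * w k) • 1) (jmInv S j) :=
        ((cX.mul_left cD).sub_left ((Commute.one_left _).smul_left _)).add_left
          ((Commute.one_left _).smul_left _)
      rw [← mul_assoc, ← c.eq, mul_assoc, hE j (by omega), mul_smul_comm]
    have hstep : (X k * D k - (h⁻¹ : ℂ) • 1 + (h⁻¹ * w k) • 1) * E =
        (X k * D k - (h⁻¹ : ℂ) • (1 - jmInv S k)) * E := by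
      simp only [add_mul, sub_mul, smul_mul_assoc, one_mul, smul_sub, hEk, smul_smul]
      abel
    have key := H.descProd_mul hh hX hD hdd hdx (k := k) hk
    rw [List.range_succ, List.map_append, List.prod_append, List.map_append, List.prod_append,
      List.map_singleton, List.prod_singleton, List.map_singleton, List.prod_singleton,
      mul_assoc, ih (by omega) _ hE', hstep, Finset.prod_range_succ, mul_smul]
    congr 1
    calc _ = ((List.range k).map X).prod *
          (descProd D k * (X k * D k - (h⁻¹ : ℂ) • (1 - jmInv S k))) * E := by
            simp only [mul_assoc]
      _ = ((List.range k).map X).prod * X k * descProd D (k + 1) * (jmInv S k * E) := by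
            rw [key]; simp only [mul_assoc]
      _ = _ := by rw [hEk, mul_smul_comm]

end HeckeChain

section Embeddings

/-- The ring homomorphism `X ↦ X ⊗ 1` along a splitting `I ≃ J × K` of the index type. -/
def blockEmb {A I J K : Type} [Ring A] [Fintype I] [Fintype J] [Fintype K]
    [DecidableEq I] [DecidableEq J] [DecidableEq K] (e : I ≃ J × K) : Matrix J J A →+* Matrix I I A :=
  ((Matrix.reindexRingEquiv A e.symm).toRingHom.comp
    (Matrix.blockDiagonalRingHom J K A)).comp (Pi.constRingHom K (Matrix J J A))

theorem blockEmb_apply {A I J K : Type} [Ring A] [Fintype I] [Fintype J] [Fintype K]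
    [DecidableEq I] [DecidableEq J] [DecidableEq K] (e : I ≃ J × K) (X : Matrix J J A) (i j : I) :
    blockEmb e X i j = if (e i).2 = (e j).2 then X (e i).1 (e j).1 else 0 := by
  change Matrix.blockDiagonal (fun _ : K => X) (e i) (e j) = _
  rw [Matrix.blockDiagonal_apply]

theorem blockEmb_smul {A I J K : Type} [Ring A] [Algebra ℂ A] [Fintype I] [Fintype J]
    [Fintype K] [DecidableEq I] [DecidableEq J] [DecidableEq K] (e : I ≃ J × K) (c : ℂ) (X : Matrix J J A) :
    blockEmb e (c • X) = c • blockEmb e X := by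
  ext i j
  simp only [blockEmb_apply, Matrix.smul_apply]
  split_ifs <;> simp

/-- Splitting off the coordinates `a` and `b`. -/
def pairSplit {ι β : Type} (a b : ι) (hab : a ≠ b) :
    (ι → β) ≃ (β × β) × ({c : ι // c ≠ a ∧ c ≠ b} → β) where
  toFun f := ((f a, f b), fun c => f c)
  invFun p c := if ha : c = a then p.1.1 else if hb : c = b then p.1.2 else p.2 ⟨c, ha, hb⟩
  left_inv f := by
    funext c
    by_cases ha : c = a
    · simp [ha]
    · by_cases hb : c = b
      · subst hb; simp [ha]
      · simp [ha, hb]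
  right_inv p := by
    refine Prod.ext (Prod.ext ?_ ?_) ?_
    · simp
    · simp [hab.symm]
    · funext c
      simp [c.2.1, c.2.2]

variable {A : Type} [Ring A] {n m : ℕ}

theorem leg1_eq_blockEmb (X : Matrix (Fin n) (Fin n) A) (a : Fin m) :
    leg1 n m X a = blockEmb (Equiv.funSplitAt a (Fin n)) X := by
  ext i j
  rw [blockEmb_apply]
  simp only [leg1, a.2, dif_pos, Fin.eta, Equiv.funSplitAt_apply, funext_iff, Subtype.forall,
    ne_eq, Fin.ext_iff]

theorem leg1_eq_blockEmb_pair (X : Matrix (Fin n) (Fin n) A) {a b : Fin m} (hab : a ≠ b) :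
    leg1 n m X a = blockEmb (pairSplit a b hab) (M1 X) := by
  ext i j
  rw [blockEmb_apply]
  simp only [leg1, M1, a.2, dif_pos, Fin.eta, pairSplit, Equiv.coe_fn_mk, funext_iff,
    Subtype.forall]
  by_cases h : ∀ c : Fin m, (c : ℕ) ≠ a → i c = j c
  · rw [if_pos h, if_pos fun c hc => h c fun h' => hc.1 (Fin.ext h')]
    exact (if_pos (h b fun h' => hab (Fin.ext h').symm)).symm
  · rw [if_neg h]
    split_ifs with h1 h2
    · refine absurd (fun c hc => ?_) h
      by_cases hb : c = b
      · rw [hb, h2]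
      · exact h1 c ⟨fun h' => hc (congrArg Fin.val h'), hb⟩
    · exact (if_neg h2).symm
    · rfl

theorem leg2_eq_blockEmb [Algebra ℂ A] (C : Matrix (Fin n × Fin n) (Fin n × Fin n) ℂ)
    {a b : Fin m} (hab : a ≠ b) :
    leg2 A n m C a b = blockEmb (pairSplit a b hab) (C.map (algebraMap ℂ A)) := by
  ext i j
  rw [blockEmb_apply]
  simp only [leg2, a.2, b.2, and_self, dif_pos, Fin.eta, pairSplit, Equiv.coe_fn_mk,
    funext_iff, Subtype.forall, Matrix.map_apply, ne_eq, Fin.ext_iff, and_imp]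

theorem leg2_eq_map [Algebra ℂ A] (C : Matrix (Fin n × Fin n) (Fin n × Fin n) ℂ) (a b : ℕ) :
    leg2 A n m C a b = (leg2 ℂ n m C a b).map (algebraMap ℂ A) := by
  ext i j
  simp only [leg2, Matrix.map_apply, Algebra.algebraMap_self, RingHom.id_apply]
  split_ifs <;> simp

theorem commute_leg1_leg2 [Algebra ℂ A] (X : Matrix (Fin n) (Fin n) A)
    (C : Matrix (Fin n × Fin n) (Fin n × Fin n) ℂ) {a b c : Fin m} (hab : a ≠ b)
    (hac : a ≠ c) : Commute (leg1 n m X a) (leg2 A n m C b c) := by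
  change leg1 n m X a * leg2 A n m C b c = leg2 A n m C b c * leg1 n m X a
  have h1 : ∀ i j, leg1 n m X a i j =
      if ∀ d, d ≠ a → i d = j d then X (i a) (j a) else 0 := by
    intro i j
    simp only [leg1, a.2, dif_pos, Fin.eta, ne_eq, Fin.ext_iff]
  have h2 : ∀ i j, leg2 A n m C b c i j =
      if ∀ d, d ≠ b → d ≠ c → i d = j d then
        algebraMap ℂ A (C (i b, i c) (j b, j c)) else 0 := by
    intro i j
    simp only [leg2, b.2, c.2, and_self, dif_pos, Fin.eta, ne_eq, Fin.ext_iff]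
  ext i j
  rw [Matrix.mul_apply, Matrix.mul_apply,
    Finset.sum_eq_single (Function.update i a (j a)),
    Finset.sum_eq_single (Function.update j a (i a))]
  · simp only [h1, h2, Function.update_self, Function.update_of_ne hab.symm,
      Function.update_of_ne hac.symm]
    rw [if_pos fun d hd => (Function.update_of_ne hd _ _).symm,
      if_pos fun d hd => Function.update_of_ne hd _ _]
    have hiff : (∀ d, d ≠ b → d ≠ c → Function.update i a (j a) d = j d) ↔
        ∀ d, d ≠ b → d ≠ c → i d = Function.update j a (i a) d := by
      refine forall_congr' fun d => ?_
      by_cases hd : d = a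
      · subst hd; simp
      · simp [Function.update_of_ne hd]
    by_cases hc : ∀ d, d ≠ b → d ≠ c → Function.update i a (j a) d = j d
    · rw [if_pos hc, if_pos (hiff.1 hc), Algebra.commutes]
    · rw [if_neg hc, if_neg (mt hiff.2 hc), mul_zero, zero_mul]
  · intro l _ hl
    rw [h1 l j]
    split_ifs with hlj
    · rw [h2, if_neg, zero_mul]
      intro h
      refine hl (funext fun d => ?_)
      by_cases hd : d = a
      · subst hd; rw [Function.update_self, h d hab hac]
      · rw [Function.update_of_ne hd, hlj d hd]
    · rw [mul_zero]
  · simp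
  · intro l _ hl
    rw [h1 i l]
    split_ifs with hil
    · rw [h2, if_neg, mul_zero]
      intro h
      refine hl (funext fun d => ?_)
      by_cases hd : d = a
      · subst hd; rw [Function.update_self, h d hab hac]
      · rw [Function.update_of_ne hd, hil d hd]
    · rw [zero_mul]
  · simp

end Embeddings

section RMatrix

variable {q : ℂ} {n : ℕ}

theorem Rcheck_apply (p r : Fin n × Fin n) :
    Rcheck q n p r = (if p.swap = r then (if p.1 = p.2 then q else 1) else 0) +
      (if p = r then (if p.2 < p.1 then q - q⁻¹ else 0) else 0) := by
  have h : Rcheck q n p r = Rmat q n p.swap r := by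
    rw [Rcheck, Matrix.mul_apply, Finset.sum_eq_single p.swap]
    · simp [Pmat]
    · intro x _ hx
      rw [Pmat, if_neg, zero_mul]
      rintro ⟨h1, h2⟩
      exact hx (Prod.ext h2.symm h1.symm)
    · simp
  rw [h]
  obtain ⟨a, b⟩ := p
  obtain ⟨c, d⟩ := r
  simp only [Rmat, Prod.swap_prod_mk, Prod.mk.injEq]
  by_cases h1 : b = c ∧ a = d
  · obtain ⟨rfl, rfl⟩ := h1
    by_cases hab : a = b
    · subst hab; simp
    · simp [hab, Ne.symm hab]
  · rw [if_neg h1, if_neg h1, zero_add]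
    by_cases h2 : a = c ∧ b = d
    · obtain ⟨rfl, rfl⟩ := h2; simp
    · rw [if_neg h2, if_neg]
      exact fun h => h2 ⟨h.1, h.2.1⟩

theorem Rcheck_mul_self (hq : q ≠ 0) :
    Rcheck q n * Rcheck q n = (q - q⁻¹) • Rcheck q n + 1 := by
  ext p r
  have hsum : (Rcheck q n * Rcheck q n) p r =
      (if p.1 = p.2 then q else 1) * Rcheck q n p.swap r +
        (if p.2 < p.1 then q - q⁻¹ else 0) * Rcheck q n p r := by
    rw [Matrix.mul_apply]
    have h : ∀ x, Rcheck q n p x * Rcheck q n x r =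
        (if p.swap = x then (if p.1 = p.2 then q else 1) * Rcheck q n x r else 0) +
          (if p = x then (if p.2 < p.1 then q - q⁻¹ else 0) * Rcheck q n x r else 0) := by
      intro x
      rw [Rcheck_apply p x]
      split_ifs <;> ring
    simp only [h, Finset.sum_add_distrib, Finset.sum_ite_eq, Finset.mem_univ, if_true]
  rw [hsum, Matrix.add_apply, Matrix.smul_apply, Matrix.one_apply, Rcheck_apply, Rcheck_apply,
    smul_eq_mul]
  obtain ⟨a, b⟩ := p
  simp only [Prod.swap_prod_mk]
  rcases lt_trichotomy a b with hab | rfl | hab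
  · simp only [hab.ne, hab.ne', hab, hab.not_gt, if_true, if_false]
    split_ifs <;> ring
  · simp only [lt_irrefl, if_true, if_false]
    split_ifs
    · field_simp; ring
    · ring
  · simp only [hab.ne, hab.ne', hab, hab.not_gt, if_true, if_false]
    split_ifs <;> ring

theorem Rcheck_inv (hq : q ≠ 0) : (Rcheck q n)⁻¹ = Rcheck q n - (q - q⁻¹) • 1 := by
  refine Matrix.inv_eq_right_inv ?_
  rw [mul_sub, Rcheck_mul_self hq, mul_smul_comm, mul_one, add_sub_cancel_left]

theorem Rcheck_mul_inv (hq : q ≠ 0) : Rcheck q n * (Rcheck q n)⁻¹ = 1 := by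
  rw [Rcheck_inv hq, mul_sub, Rcheck_mul_self hq, mul_smul_comm, mul_one, add_sub_cancel_left]

theorem Rcheck_inv_mul (hq : q ≠ 0) : (Rcheck q n)⁻¹ * Rcheck q n = 1 :=
  mul_eq_one_comm.1 (Rcheck_mul_inv hq)

end RMatrix

section WeylRelations

variable (q : ℂ) (n : ℕ)

theorem mapMatrix_RcW : (RingQuot.mkAlgHom ℂ (WRel q n)).mapMatrix (RcW q n) =
    (Rcheck q n).map (algebraMap ℂ (Weyl q n)) := by
  ext x y
  exact AlgHom.commutes _ _

theorem mapMatrix_RcWInv : (RingQuot.mkAlgHom ℂ (WRel q n)).mapMatrix (RcWInv q n) =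
    (Rcheck q n)⁻¹.map (algebraMap ℂ (Weyl q n)) := by
  ext x y
  exact AlgHom.commutes _ _

theorem mapMatrix_M1_mgF : (RingQuot.mkAlgHom ℂ (WRel q n)).mapMatrix (M1 (mgF n)) =
    M1 (Mmat q n) := by
  ext x y
  simp only [AlgHom.mapMatrix_apply, Matrix.map_apply, M1]
  split_ifs
  · rfl
  · exact map_zero _

theorem mapMatrix_M1_dgF : (RingQuot.mkAlgHom ℂ (WRel q n)).mapMatrix (M1 (dgF n)) =
    M1 (Dmat q n) := by
  ext x y
  simp only [AlgHom.mapMatrix_apply, Matrix.map_apply, M1]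
  split_ifs
  · rfl
  · exact map_zero _

theorem weyl_reflection :
    (Rcheck q n)⁻¹.map (algebraMap ℂ (Weyl q n)) * M1 (Dmat q n) *
        (Rcheck q n)⁻¹.map (algebraMap ℂ (Weyl q n)) * M1 (Dmat q n) =
      M1 (Dmat q n) * (Rcheck q n)⁻¹.map (algebraMap ℂ (Weyl q n)) * M1 (Dmat q n) *
        (Rcheck q n)⁻¹.map (algebraMap ℂ (Weyl q n)) := by
  have h : (RingQuot.mkAlgHom ℂ (WRel q n)).mapMatrix
        (RcWInv q n * M1 (dgF n) * RcWInv q n * M1 (dgF n)) =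
      (RingQuot.mkAlgHom ℂ (WRel q n)).mapMatrix
        (M1 (dgF n) * RcWInv q n * M1 (dgF n) * RcWInv q n) := by
    ext x y
    exact RingQuot.mkAlgHom_rel ℂ (WRel.dd x y)
  simpa only [map_mul, mapMatrix_RcWInv, mapMatrix_M1_dgF] using h

theorem weyl_cross :
    M1 (Dmat q n) * (Rcheck q n).map (algebraMap ℂ (Weyl q n)) * M1 (Mmat q n) =
      (Rcheck q n).map (algebraMap ℂ (Weyl q n)) * M1 (Mmat q n) *
        (Rcheck q n)⁻¹.map (algebraMap ℂ (Weyl q n)) * M1 (Dmat q n) *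
        (Rcheck q n)⁻¹.map (algebraMap ℂ (Weyl q n)) + 1 := by
  have h : (RingQuot.mkAlgHom ℂ (WRel q n)).mapMatrix (M1 (dgF n) * RcW q n * M1 (mgF n)) =
      (RingQuot.mkAlgHom ℂ (WRel q n)).mapMatrix
        (RcW q n * M1 (mgF n) * RcWInv q n * M1 (dgF n) * RcWInv q n + 1) := by
    ext x y
    exact RingQuot.mkAlgHom_rel ℂ (WRel.dm x y)
  simpa only [map_mul, map_add, map_one, mapMatrix_RcW, mapMatrix_RcWInv, mapMatrix_M1_dgF,
    mapMatrix_M1_mgF] using h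

end WeylRelations

section TensorPower

variable {A : Type} [Ring A] [Algebra ℂ A] {q : ℂ} {n m : ℕ}

theorem RcLeg_eq_blockEmb {k : ℕ} (hk : k + 1 < m) :
    RcLeg A q n m k = blockEmb (pairSplit (⟨k, by omega⟩ : Fin m) ⟨k + 1, hk⟩ (by simp))
      ((Rcheck q n).map (algebraMap ℂ A)) :=
  leg2_eq_blockEmb (Rcheck q n) (a := (⟨k, by omega⟩ : Fin m)) (b := ⟨k + 1, hk⟩) (by simp)

theorem RcLegInv_eq_blockEmb {k : ℕ} (hk : k + 1 < m) :
    RcLegInv A q n m k = blockEmb (pairSplit (⟨k, by omega⟩ : Fin m) ⟨k + 1, hk⟩ (by simp))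
      ((Rcheck q n)⁻¹.map (algebraMap ℂ A)) :=
  leg2_eq_blockEmb (Rcheck q n)⁻¹ (a := (⟨k, by omega⟩ : Fin m)) (b := ⟨k + 1, hk⟩) (by simp)

theorem RcLeg_mul_inv (hq : q ≠ 0) {k : ℕ} (hk : k + 1 < m) :
    RcLeg A q n m k * RcLegInv A q n m k = 1 := by
  rw [RcLeg_eq_blockEmb hk, RcLegInv_eq_blockEmb hk, ← map_mul, ← Matrix.map_mul,
    Rcheck_mul_inv hq, Matrix.map_one _ (map_zero _) (map_one _), map_one]

theorem RcLegInv_mul (hq : q ≠ 0) {k : ℕ} (hk : k + 1 < m) :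
    RcLegInv A q n m k * RcLeg A q n m k = 1 := by
  rw [RcLeg_eq_blockEmb hk, RcLegInv_eq_blockEmb hk, ← map_mul, ← Matrix.map_mul,
    Rcheck_inv_mul hq, Matrix.map_one _ (map_zero _) (map_one _), map_one]

theorem RcLeg_sub_inv (hq : q ≠ 0) {k : ℕ} (hk : k + 1 < m) :
    RcLeg A q n m k - RcLegInv A q n m k = (q - q⁻¹) • 1 := by
  have h : (Rcheck q n).map (algebraMap ℂ A) - (Rcheck q n)⁻¹.map (algebraMap ℂ A) =
      (q - q⁻¹) • 1 := by
    rw [Rcheck_inv hq]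
    ext x y
    by_cases hxy : x = y
    · subst hxy; simp [Algebra.algebraMap_eq_smul_one, sub_smul]
    · simp [hxy]
  rw [RcLeg_eq_blockEmb hk, RcLegInv_eq_blockEmb hk, ← map_sub, h, blockEmb_smul, map_one]

theorem RcLeg_eq_mapMatrix (k : ℕ) :
    RcLeg A q n m k = (Algebra.ofId ℂ A).mapMatrix (RcLeg ℂ q n m k) :=
  leg2_eq_map _ _ _

theorem Tn_braid {k : ℕ} (hk : k + 2 < m) :
    Tn q m k * Tn q m (k + 1) * Tn q m k = Tn q m (k + 1) * Tn q m k * Tn q m (k + 1) := by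
  have h1 : k < m - 1 := by omega
  have h2 : k + 1 < m - 1 := by omega
  simp only [Tn, dif_pos h1, dif_pos h2, Tgen, ← map_mul]
  exact RingQuot.mkAlgHom_rel ℂ (HeckeRel.braid ⟨k, h1⟩ ⟨k + 1, h2⟩ rfl)

theorem Tn_commute {i j : ℕ} (hij : i + 1 < j) (hj : j + 1 < m) :
    Commute (Tn q m i) (Tn q m j) := by
  have h1 : i < m - 1 := by omega
  have h2 : j < m - 1 := by omega
  change _ * _ = _ * _
  simp only [Tn, dif_pos h1, dif_pos h2, Tgen, ← map_mul]
  exact RingQuot.mkAlgHom_rel ℂ (HeckeRel.commute ⟨i, h1⟩ ⟨j, h2⟩ hij)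

theorem heckeChain_RcLeg (A : Type) [Ring A] [Algebra ℂ A] (hq : q ≠ 0)
    {φ : Hecke q m →ₐ[ℂ] Matrix (Fin m → Fin n) (Fin m → Fin n) ℂ} (hφ : IsHeckeRep q n m φ) :
    HeckeChain (q - q⁻¹) m (RcLeg A q n m) (RcLegInv A q n m) where
  mul_inv k hk := RcLeg_mul_inv hq hk
  inv_mul k hk := RcLegInv_mul hq hk
  sub_inv k hk := RcLeg_sub_inv hq hk
  braid k hk := by
    rw [RcLeg_eq_mapMatrix k, RcLeg_eq_mapMatrix (k + 1), ← hφ k (by omega),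
      ← hφ (k + 1) (by omega)]
    simp only [← map_mul, Tn_braid hk]
  far i j hij hj := by
    rw [RcLeg_eq_mapMatrix i, RcLeg_eq_mapMatrix j, ← hφ i (by omega), ← hφ j (by omega)]
    exact ((Tn_commute hij hj).map φ).map _

theorem conjChain_legBar (X : Matrix (Fin n) (Fin n) A) :
    ConjChain m (RcLeg A q n m) (RcLegInv A q n m) (legBar q n m X) where
  zero k hk hkm := commute_leg1_leg2 X (Rcheck q n) (a := ⟨0, by omega⟩) (b := ⟨k, by omega⟩)
    (c := ⟨k + 1, hkm⟩) (by simp; omega) (by simp)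
  succ _ _ := rfl

theorem legBar_mul_sub (hq : q ≠ 0) (X Y : Matrix (Fin n) (Fin n) A) (c : ℂ) {k : ℕ}
    (hk : k < m) :
    legBar q n m (X * Y - c • 1) k = legBar q n m X k * legBar q n m Y k - c • 1 := by
  induction k with
  | zero =>
    have h : ∀ Z : Matrix (Fin n) (Fin n) A, leg1 n m Z 0 =
        blockEmb (Equiv.funSplitAt (⟨0, hk⟩ : Fin m) (Fin n)) Z :=
      fun Z => leg1_eq_blockEmb Z (⟨0, hk⟩ : Fin m)
    change leg1 n m _ 0 = leg1 n m _ 0 * leg1 n m _ 0 - _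
    rw [h, h, h, map_sub, map_mul, blockEmb_smul, map_one]
  | succ k ih =>
    change RcLeg A q n m k * legBar q n m _ k * RcLegInv A q n m k =
      (RcLeg A q n m k * legBar q n m _ k * RcLegInv A q n m k) *
        (RcLeg A q n m k * legBar q n m _ k * RcLegInv A q n m k) - _
    rw [ih (by omega), mul_sub, sub_mul, mul_smul_comm, smul_mul_assoc, mul_one,
      RcLeg_mul_inv hq hk]
    congr 1
    calc _ = RcLeg A q n m k * legBar q n m X k * 1 * legBar q n m Y k * RcLegInv A q n m k := by
          rw [mul_one]; simp only [mul_assoc]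
      _ = _ := by
          rw [← RcLegInv_mul hq hk]; simp only [mul_assoc]

theorem descProd_eq_prod {B : Type*} [Ring B] (D : ℕ → B) (k : ℕ) :
    descProd D k = ((List.range k).reverse.map D).prod := by
  induction k with
  | zero => simp [descProd]
  | succ k ih => simp [descProd, ih, List.range_succ]

/-- `jmInv` is inverse to the image of the Jucys–Murphy elements. -/
theorem jmInv_mul_yJM (hq : q ≠ 0)
    {φ : Hecke q m →ₐ[ℂ] Matrix (Fin m → Fin n) (Fin m → Fin n) ℂ} (hφ : IsHeckeRep q n m φ)
    {k : ℕ} (hk : k < m) :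
    jmInv (RcLegInv A q n m) k * (Algebra.ofId ℂ A).mapMatrix (φ (yJM q m (k + 1))) = 1 := by
  induction k with
  | zero => simp [jmInv, yJM]
  | succ k ih =>
    have hT : (Algebra.ofId ℂ A).mapMatrix (φ (Tp q m (k + 1))) = RcLeg A q n m k := by
      rw [RcLeg_eq_mapMatrix, ← hφ k (by omega)]; rfl
    change RcLegInv A q n m k * jmInv (RcLegInv A q n m) k * RcLegInv A q n m k *
      (Algebra.ofId ℂ A).mapMatrix (φ (Tp q m (k + 1) * yJM q m (k + 1) * Tp q m (k + 1))) = 1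
    simp only [map_mul, hT]
    have ih' := ih (by omega)
    have hST := RcLegInv_mul (A := A) (n := n) hq hk
    set Y := (Algebra.ofId ℂ A).mapMatrix (φ (yJM q m (k + 1)))
    set s := RcLegInv A q n m k
    set t := RcLeg A q n m k
    calc s * jmInv (RcLegInv A q n m) k * s * (t * Y * t)
        = s * (jmInv (RcLegInv A q n m) k * ((s * t) * Y)) * t := by simp only [mul_assoc]
      _ = 1 := by rw [hST, one_mul, ih', mul_one, hST]

theorem jmInv_mul_idem (hq : q ≠ 0)
    {φ : Hecke q m →ₐ[ℂ] Matrix (Fin m → Fin n) (Fin m → Fin n) ℂ} (hφ : IsHeckeRep q n m φ)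
    {μ : YoungDiagram} {U : StdTab μ m} {e : Hecke q m} (he : IsJMIdem q m U e)
    {k : ℕ} (hk : k < m) :
    jmInv (RcLegInv A q n m) k * (φ e).map (algebraMap ℂ A) =
      (q ^ (-2 * ctnAt U (k + 1)) : ℂ) • (φ e).map (algebraMap ℂ A) := by
  have hy := congrArg (fun x => (Algebra.ofId ℂ A).mapMatrix (φ x))
    (he.2.2 (k + 1) (by omega) (by omega)).1
  simp only [map_mul, map_smul] at hy
  have hw := jmInv_mul_yJM (A := A) hq hφ hk
  change jmInv (RcLegInv A q n m) k * (Algebra.ofId ℂ A).mapMatrix (φ e) =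
    _ • (Algebra.ofId ℂ A).mapMatrix (φ e)
  have h := congrArg (jmInv (RcLegInv A q n m) k * ·) hy
  simp only [← mul_assoc, hw, one_mul, mul_smul_comm] at h
  conv_rhs => rw [h, smul_smul, ← zpow_add₀ hq]
  simp

end TensorPower

theorem aCoeff_eq_prod_range (q : ℂ) {μ : YoungDiagram} {m : ℕ} (U : StdTab μ m) :
    aCoeff q μ = ∏ j ∈ Finset.range m, q ^ (-2 * ctnAt U (j + 1)) := by
  refine (Finset.prod_bij (fun j _ => U.pos (j + 1)) ?_ ?_ ?_ ?_).symm
  · intro j hj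
    exact U.bij.mapsTo ⟨by omega, Finset.mem_range.1 hj⟩
  · intro i hi j hj hij
    have := U.bij.injOn (x₁ := i + 1) (x₂ := j + 1) ⟨by omega, Finset.mem_range.1 hi⟩
      ⟨by omega, Finset.mem_range.1 hj⟩ hij
    omega
  · intro α hα
    obtain ⟨k, ⟨h1, h2⟩, rfl⟩ := U.bij.surjOn (Finset.mem_coe.2 hα)
    exact ⟨k - 1, Finset.mem_range.2 (by omega), by rw [Nat.sub_add_cancel h1]⟩
  · intro j _
    rfl

theorem sub_inv_ne_zero_of_notRootOfUnity {q : ℂ} (hq : q ≠ 0) (hq' : NotRootOfUnity q) :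
    q - q⁻¹ ≠ 0 := by
  intro h
  refine hq' 2 (by norm_num) ?_
  rw [pow_two]
  nth_rewrite 2 [sub_eq_zero.1 h]
  exact mul_inv_cancel₀ hq

/-- the higher quantum Capelli identity in the braided Weyl algebra:
`(L_{1̄} + q^{−2c₁(U)}/(q−q⁻¹)) ⋯ (L_{m̄} + q^{−2c_m(U)}/(q−q⁻¹)) E_U
  = a_μ M_{1̄} ⋯ M_{m̄} 𝒟_{m̄} ⋯ 𝒟_{1̄} E_U` with `L = M𝒟 − (q−q⁻¹)⁻¹`. -/
theorem higher_capelli_matrix (n : ℕ) (hn : 1 ≤ n) (q : ℂ) (hq : q ≠ 0)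
    (hq' : NotRootOfUnity q) (m : ℕ) (μ : YoungDiagram) (hcard : μ.cells.card = m)
    (hrow : ∀ c ∈ μ.cells, c.1 < n) (U : StdTab μ m)
    (φ : Hecke q m →ₐ[ℂ] Matrix (Fin m → Fin n) (Fin m → Fin n) ℂ)
    (hφ : IsHeckeRep q n m φ) (e : Hecke q m) (he : IsJMIdem q m U e) :
    prodU q n m U (φ e) (LW q n) ((q - q⁻¹)⁻¹) =
      aCoeff q μ •
        (((List.range m).map fun k => legBar q n m (Mmat q n) k).prod *
          ((List.range m).reverse.map fun k => legBar q n m (Dmat q n) k).prod *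
          (φ e).map (algebraMap ℂ (Weyl q n))) := by
  have hD := conjChain_legBar (q := q) (m := m) (Dmat q n)
  have hM := conjChain_legBar (q := q) (m := m) (Mmat q n)
  have key := (heckeChain_RcLeg (Weyl q n) hq hφ).capelli
    (sub_inv_ne_zero_of_notRootOfUnity hq hq') hM hD ?_ ?_
    (fun j => q ^ (-2 * ctnAt U (j + 1))) le_rfl ((φ e).map (algebraMap ℂ (Weyl q n)))
    (fun j hj => jmInv_mul_idem hq hφ he hj)
  · rw [prodU, aCoeff_eq_prod_range q U, ← descProd_eq_prod, ← key]
    congr 2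
    refine List.map_congr_left fun k hk => ?_
    rw [LW, legBar_mul_sub hq _ _ _ (List.mem_range.1 hk)]
  · intro hm
    have h := fun Z : Matrix (Fin n) (Fin n) (Weyl q n) => leg1_eq_blockEmb_pair Z
      (a := (⟨0, by omega⟩ : Fin m)) (b := ⟨0 + 1, hm⟩) (by simp)
    dsimp only at h
    change RcLegInv _ q n m 0 * leg1 n m _ 0 * RcLegInv _ q n m 0 * leg1 n m _ 0 =
      leg1 n m _ 0 * RcLegInv _ q n m 0 * leg1 n m _ 0 * RcLegInv _ q n m 0
    simp only [h, RcLegInv_eq_blockEmb hm, ← map_mul, weyl_reflection]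
  · intro hm
    have h := fun Z : Matrix (Fin n) (Fin n) (Weyl q n) => leg1_eq_blockEmb_pair Z
      (a := (⟨0, by omega⟩ : Fin m)) (b := ⟨0 + 1, hm⟩) (by simp)
    dsimp only at h
    change leg1 n m _ 0 * RcLeg _ q n m 0 * leg1 n m _ 0 =
      RcLeg _ q n m 0 * leg1 n m _ 0 * RcLegInv _ q n m 0 * leg1 n m _ 0 *
        RcLegInv _ q n m 0 + 1
    simp only [h, RcLeg_eq_blockEmb hm, RcLegInv_eq_blockEmb hm, ← map_mul, weyl_cross,
      map_add, map_one]

end QImm
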